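/- The free group on countably infinitely many generators (the free group on the set ℕ) does not have the strong topological Rokhlin property. -/

import Mathlib

open Topology

/-- The Cantor space `𝒞`. -/
abbrev Cantor : Type := ℕ → Bool

/-- `α : G → C(𝒞,𝒞)` is a continuous action if it is a homomorphism into the
self-homeomorphisms of `𝒞` (recorded as continuous maps; continuity of the inverse
`α g⁻¹` is automatic from the homomorphism equations). -/
def IsAction (G : Type) [Group G] (α : G → C(Cantor, Cantor)) : Prop :=
  α 1 = ContinuousMap.id Cantor ∧ ∀ g h : G, α (g * h) = (α g).comp (α h)

/-- The space `Act_G(𝒞)` of continuous actions of `G` on the Cantor space,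
topologized as a subspace of `C(𝒞,𝒞)^G` (compact-open topology on each factor). -/
abbrev ActSpace (G : Type) [Group G] : Type :=
  {α : G → C(Cantor, Cantor) // IsAction G α}

/-- The conjugacy class of an action `α` under the conjugation action of `Homeo(𝒞)`. -/
def conjClass {G : Type} [Group G] (α : ActSpace G) : Set (ActSpace G) :=
  {β | ∃ φ : Cantor ≃ₜ Cantor, ∀ g : G,
    (β.1 g : Cantor → Cantor) = φ ∘ (α.1 g : Cantor → Cantor) ∘ φ.symm}

/-- The strong topological Rokhlin property: some action on the Cantor space has a
comeager conjugacy class. -/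
def HasSTRP (G : Type) [Group G] : Prop :=
  ∃ α : ActSpace G, conjClass α ∈ residual (ActSpace G)

/-- The shift action of `G` on `A^G`: `(g • x)(h) = x(g⁻¹h)`. -/
def shift {G : Type} [Group G] {A : Type} (g : G) (x : G → A) : G → A :=
  fun h => x (g⁻¹ * h)

/-- A subshift: closed (in the product of discrete topologies) and shift-invariant. -/
def IsSubshift (G : Type) [Group G] (A : Type) (X : Set (G → A)) : Prop :=
  (letI : TopologicalSpace A := ⊥; IsClosed X) ∧ ∀ g : G, ∀ x ∈ X, shift g x ∈ X

/-- The set `X_F` of `F`-patterns of `X`. -/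
def patterns {G A : Type} (F : Finset G) (X : Set (G → A)) : Set (F → A) :=
  (fun (x : G → A) (f : F) => x (f : G)) '' X

/-- Subshift of finite type, with defining window `E` and allowed patterns `𝔽`. -/
def IsSFT (G : Type) [Group G] (A : Type) (X : Set (G → A)) : Prop :=
  ∃ (E : Finset G) (𝔽 : Set (E → A)),
    ∀ x : G → A, x ∈ X ↔ ∀ g : G, (fun e : E => shift g x (e : G)) ∈ 𝔽

/-- Continuity on a set, for a map between full shift spaces over discrete alphabets. -/
def ContinuousOnD {G A B : Type} (ψ : (G → B) → (G → A)) (Z : Set (G → B)) : Prop :=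
  letI : TopologicalSpace A := ⊥
  letI : TopologicalSpace B := ⊥
  ContinuousOn ψ Z

/-- `G`-equivariance of a map between shift spaces, on a set. -/
def EquivariantOn {G A B : Type} [Group G] (ψ : (G → B) → (G → A)) (Z : Set (G → B)) : Prop :=
  ∀ g : G, ∀ z ∈ Z, ψ (shift g z) = shift g (ψ z)

/-- A sofic subshift: a continuous `G`-equivariant image of a subshift of finite type. -/
def IsSofic (G : Type) [Group G] (A : Type) (X : Set (G → A)) : Prop :=
  ∃ (B : Type) (_ : Fintype B) (_ : Nontrivial B) (Z : Set (G → B))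
    (ψ : (G → B) → (G → A)),
    IsSubshift G B Z ∧ IsSFT G B Z ∧ ContinuousOnD ψ Z ∧ EquivariantOn ψ Z ∧ ψ '' Z = X

/-- The sliding block code `Φ(y)(g) = f(d ↦ y(g·d))` induced by `f : (D → B) → A`. -/
def slidingBlock {G : Type} [Group G] {A B : Type} (D : Finset G)
    (f : (D → B) → A) : (G → B) → (G → A) :=
  fun y g => f (fun d => y (g * (d : G)))

/-- A projectively isolated subshift. -/
def ProjIsolated (G : Type) [Group G] (A : Type) (X : Set (G → A)) : Prop :=
  ∃ (B : Type) (_ : Fintype B) (_ : Nontrivial B) (Y : Set (G → B))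
    (F D : Finset G) (f : (D → B) → A),
    IsSubshift G B Y ∧
    slidingBlock D f '' Y = X ∧
    ∀ Z : Set (G → B), IsSubshift G B Z → patterns F Z = patterns F Y →
      slidingBlock D f '' Z = X

/-- An isolated subshift: an SFT `X` such that for some finite `F ⊆ G` no proper
subshift has the same `F`-patterns as `X`. -/
def IsIsolated (G : Type) [Group G] (A : Type) (X : Set (G → A)) : Prop :=
  IsSFT G A X ∧ ∃ F : Finset G, ∀ Y : Set (G → A),
    IsSubshift G A Y → Y ⊂ X → patterns F Y ≠ patterns F X

/-- A strongly projectively isolated subshift: a continuous `G`-equivariant image of an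
isolated subshift. -/
def StronglyProjIsolated (G : Type) [Group G] (A : Type) (X : Set (G → A)) : Prop :=
  ∃ (B : Type) (_ : Fintype B) (_ : Nontrivial B) (Y : Set (G → B))
    (ψ : (G → B) → (G → A)),
    IsSubshift G B Y ∧ IsIsolated G B Y ∧
    ContinuousOnD ψ Y ∧ EquivariantOn ψ Y ∧ ψ '' Y = X

/-- Shadowing (the pseudo-orbit tracing property) of an action `act` of `G`,
with respect to a distance function `d`. -/
def HasShadowing {G X : Type} [Group G] (d : X → X → ℝ) (act : G → X → X) : Prop :=
  ∀ ε : ℝ, 0 < ε → ∃ (δ : ℝ) (S : Finset G), 0 < δ ∧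
    ∀ x : G → X, (∀ g : G, ∀ s ∈ S, d (act s (x g)) (x (s * g)) < δ) →
      ∃ y : X, ∀ g : G, d (x g) (act g y) < ε

/-- A finite partition of the whole space into nonempty clopen sets. -/
def IsClopenPartition {X : Type} [TopologicalSpace X] (parts : Finset (Set X)) : Prop :=
  (∀ P ∈ parts, IsClopen P ∧ P.Nonempty) ∧
  (∀ P ∈ parts, ∀ Q ∈ parts, P ≠ Q → Disjoint P Q) ∧
  (⋃ P ∈ parts, P) = Set.univ

/-- A finite partition of a subshift `X` into nonempty subsets that are clopen in `X`. -/
def IsClopenPartitionIn {G A : Type} (X : Set (G → A)) (parts : Finset (Set (G → A))) : Prop :=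
  (letI : TopologicalSpace A := ⊥;
    ∀ P ∈ parts, P.Nonempty ∧ P ⊆ X ∧ IsClopen (Subtype.val ⁻¹' P : Set X)) ∧
  (∀ P ∈ parts, ∀ Q ∈ parts, P ≠ Q → Disjoint P Q) ∧
  (⋃ P ∈ parts, P) = X

/-- `X` is `fam`-minimal: no nonempty proper subshift of `X` meets every member of `fam`. -/
def AMinimal {G A : Type} [Group G] (X : Set (G → A)) (fam : Set (Set (G → A))) : Prop :=
  ¬ ∃ Y : Set (G → A), IsSubshift G A Y ∧ Y.Nonempty ∧ Y ⊂ X ∧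
    ∀ S ∈ fam, (Y ∩ S).Nonempty

/-- The free product of a subshift `V ⊆ B^G` and a subshift `W ⊆ B^H`, a subshift
of `B^(G∗H)`. -/
def freeProd {G H B : Type} [Group G] [Group H]
    (V : Set (G → B)) (W : Set (H → B)) : Set (Monoid.Coprod G H → B) :=
  {x | ∀ g : Monoid.Coprod G H,
    (fun h : G => x (g * Monoid.Coprod.inl h)) ∈ V ∧
    (fun k : H => x (g * Monoid.Coprod.inr k)) ∈ W}

/-- The action of `G` on the Cantor space given by a homomorphism into its homeomorphisms. -/
def actionOfHom {G : Type} [Group G] (ρ : G →* (Cantor ≃ₜ Cantor)) : ActSpace G :=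
  ⟨fun g => (ρ g : C(Cantor, Cantor)), by
    refine ⟨?_, fun g h => ?_⟩
    · ext1 x
      simp
    · ext1 x
      simp⟩

/-- The homeomorphism by which a group element acts. -/
def ActSpace.toHomeo {G : Type} [Group G] (α : ActSpace G) (g : G) : Cantor ≃ₜ Cantor where
  toFun := α.1 g
  invFun := α.1 g⁻¹
  left_inv x := by
    rw [← ContinuousMap.comp_apply, ← α.2.2, inv_mul_cancel, α.2.1, ContinuousMap.id_apply]
  right_inv x := by
    rw [← ContinuousMap.comp_apply, ← α.2.2, mul_inv_cancel, α.2.1, ContinuousMap.id_apply]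
  continuous_toFun := (α.1 g).continuous
  continuous_invFun := (α.1 g⁻¹).continuous

/-- The homomorphism into the homeomorphism group underlying an action. -/
def ActSpace.toHom {G : Type} [Group G] (α : ActSpace G) : G →* (Cantor ≃ₜ Cantor) where
  toFun := α.toHomeo
  map_one' := by
    ext1 x
    exact DFunLike.congr_fun α.2.1 x
  map_mul' g h := by
    ext1 x
    exact DFunLike.congr_fun (α.2.2 g h) x

lemma isClosed_isAction (G : Type) [Group G] :
    IsClosed {α : G → C(Cantor, Cantor) | IsAction G α} := by
  simp only [IsAction, Set.ofPred_and, Set.ofPred_forall]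
  refine (isClosed_eq (continuous_apply _) continuous_const).inter
    (isClosed_iInter fun g => isClosed_iInter fun h => isClosed_eq (continuous_apply _) ?_)
  exact (continuous_apply g).compCM (continuous_apply h)

lemma baireSpace_actSpace (G : Type) [Group G] [Countable G] : BaireSpace (ActSpace G) := by
  have : CompleteSpace (ActSpace G) := (isClosed_isAction G).completeSpace_coe
  have : (uniformity Bool).IsCountablyGenerated := by
    rw [DiscreteUniformity.eq_principal_setRelId]
    infer_instance
  have : (uniformity (ActSpace G)).IsCountablyGenerated :=
    Filter.comap.isCountablyGenerated _ _
  infer_instance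

/-- The action of a free group obtained by replacing the homeomorphism assigned to the
generator `n` by `h`. -/
def replaceGen (β : ActSpace (FreeGroup ℕ)) (h : Cantor ≃ₜ Cantor) (n : ℕ) :
    ActSpace (FreeGroup ℕ) :=
  actionOfHom (FreeGroup.lift (Function.update (fun i => β.toHom (FreeGroup.of i)) n h))

lemma replaceGen_of (β : ActSpace (FreeGroup ℕ)) (h : Cantor ≃ₜ Cantor) (n : ℕ) :
    (replaceGen β h n).1 (FreeGroup.of n) = (h : C(Cantor, Cantor)) := by
  simp [replaceGen, actionOfHom]

lemma eventually_lift_update_eq {H : Type*} [Group H] (ρ : FreeGroup ℕ →* H) (h : H)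
    (g : FreeGroup ℕ) :
    ∀ᶠ n in Filter.atTop,
      FreeGroup.lift (Function.update (fun i => ρ (FreeGroup.of i)) n h) g = ρ g := by
  induction g using FreeGroup.induction_on with
  | C1 => simp
  | of i =>
    filter_upwards [Filter.eventually_gt_atTop i] with n hn
    simp [Function.update_of_ne hn.ne]
  | inv_of i hi =>
    filter_upwards [hi] with n hn
    rw [map_inv, map_inv, hn]
  | mul x y hx hy =>
    filter_upwards [hx, hy] with n hn hn'
    rw [map_mul, map_mul, hn, hn']

lemma tendsto_replaceGen (β : ActSpace (FreeGroup ℕ)) (h : Cantor ≃ₜ Cantor) :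
    Filter.Tendsto (replaceGen β h) Filter.atTop (𝓝 β) := by
  rw [tendsto_subtype_rng, tendsto_pi_nhds]
  intro g
  refine tendsto_nhds_of_eventually_eq ?_
  filter_upwards [eventually_lift_update_eq β.toHom h g] with n hn
  ext1 x
  exact DFunLike.congr_fun hn x

/-- Along any sequence of generators tending to infinity, a generic action infinitely often
sends a generator into a given open set that contains a homeomorphism. -/
lemma exists_gen_mem_mem_residual {U : Set C(Cantor, Cantor)} (hU : IsOpen U)
    {h : Cantor ≃ₜ Cantor} (hh : (h : C(Cantor, Cantor)) ∈ U) {u : ℕ → ℕ}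
    (hu : Filter.Tendsto u Filter.atTop Filter.atTop) (k : ℕ) :
    {β : ActSpace (FreeGroup ℕ) | ∃ j ≥ k, β.1 (FreeGroup.of (u j)) ∈ U} ∈
      residual (ActSpace (FreeGroup ℕ)) := by
  refine residual_of_dense_open ?_ fun β => ?_
  · have : {β : ActSpace (FreeGroup ℕ) | ∃ j ≥ k, β.1 (FreeGroup.of (u j)) ∈ U} =
        ⋃ j ≥ k, (fun β : ActSpace (FreeGroup ℕ) => β.1 (FreeGroup.of (u j))) ⁻¹' U := by
      ext β
      simp
    rw [this]
    exact isOpen_iUnion fun j => isOpen_iUnion fun _ =>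
      hU.preimage ((continuous_apply (FreeGroup.of (u j))).comp continuous_subtype_val)
  · refine mem_closure_of_tendsto ((tendsto_replaceGen β h).comp hu) ?_
    filter_upwards [Filter.eventually_ge_atTop k] with j hj
    refine ⟨j, hj, ?_⟩
    rw [Function.comp_apply, replaceGen_of]
    exact hh

lemma conjClass_mem_of_mem {G : Type} [Group G] {α β γ : ActSpace G}
    (hβ : β ∈ conjClass α) (hγ : γ ∈ conjClass α) : γ ∈ conjClass β := by
  obtain ⟨φ, hφ⟩ := hβ
  obtain ⟨ψ, hψ⟩ := hγ
  refine ⟨φ.symm.trans ψ, fun g => ?_⟩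
  ext1 x
  simp [hφ g, hψ g]

lemma tendsto_id_of_mem_conjClass {G : Type} [Group G] {α β : ActSpace G}
    (hβ : β ∈ conjClass α) {u : ℕ → G}
    (hu : Filter.Tendsto (fun j => α.1 (u j)) Filter.atTop (𝓝 (ContinuousMap.id Cantor))) :
    Filter.Tendsto (fun j => β.1 (u j)) Filter.atTop (𝓝 (ContinuousMap.id Cantor)) := by
  obtain ⟨φ, hφ⟩ := hβ
  have key := ((ContinuousMap.continuous_postcomp (φ : C(Cantor, Cantor))).comp
    (ContinuousMap.continuous_precomp (φ.symm : C(Cantor, Cantor)))).tendsto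
      (ContinuousMap.id Cantor)
  convert key.comp hu using 1
  · funext j
    ext1 x
    exact congrFun (hφ (u j)) x
  · congr 1
    ext1 x
    simp

/-- The homeomorphism of the Cantor space flipping every coordinate. -/
def flipHomeo : Cantor ≃ₜ Cantor :=
  Homeomorph.piCongrRight fun _ => (Equiv.boolNot.toHomeomorph fun s => by simp)

/-- The free group on countably infinitely many generators does not
have the strong topological Rokhlin property. -/
theorem no_strp_freeGroup_nat : ¬ HasSTRP (FreeGroup ℕ) := by
  rintro ⟨α, hα⟩
  have : Countable (FreeGroup ℕ) := Quot.mk_surjective.countable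
  have := baireSpace_actSpace (FreeGroup ℕ)
  have : Nonempty (ActSpace (FreeGroup ℕ)) := ⟨α⟩
  obtain ⟨V, hV⟩ := (𝓝 (ContinuousMap.id Cantor)).exists_antitone_basis
  have hgen (k : ℕ) : {β : ActSpace (FreeGroup ℕ) |
      ∃ j ≥ k, β.1 (FreeGroup.of j) ∈ interior (V k)} ∈ residual _ :=
    exists_gen_mem_mem_residual isOpen_interior (h := Homeomorph.refl Cantor)
      (mem_interior_iff_mem_nhds.2 (hV.mem k)) Filter.tendsto_id k
  obtain ⟨β, hβα, hβ⟩ := (dense_of_mem_residual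
    (Filter.inter_mem hα (countable_iInter_mem.2 hgen))).nonempty
  simp only [Set.mem_iInter, Set.mem_ofPred_eq] at hβ
  choose u hu huV using hβ
  have hlim : Filter.Tendsto (fun j => β.1 (FreeGroup.of (u j))) Filter.atTop
      (𝓝 (ContinuousMap.id Cantor)) := hV.tendsto fun j => interior_subset (huV j)
  let ev : C(Cantor, Cantor) → Bool := fun f => f (fun _ => false) 0
  have hev : Continuous ev := (continuous_apply 0).comp (continuous_eval_const _)
  obtain ⟨γ, hγα, hγ⟩ := (dense_of_mem_residual (Filter.inter_mem hα
    (countable_iInter_mem.2 (exists_gen_mem_mem_residual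
      ((isOpen_discrete {true}).preimage hev) (h := flipHomeo) rfl
      (Filter.tendsto_atTop_mono hu Filter.tendsto_id))))).nonempty
  have hlim' := (hev.tendsto _).comp
    (tendsto_id_of_mem_conjClass (conjClass_mem_of_mem hβα hγα) hlim)
  rw [nhds_discrete, Filter.tendsto_pure] at hlim'
  obtain ⟨N, hN⟩ := Filter.eventually_atTop.1 hlim'
  obtain ⟨j, hj, hj'⟩ := Set.mem_iInter.1 hγ N
  have hfalse : ev (γ.1 (FreeGroup.of (u j))) = false := hN j hj
  have htrue : ev (γ.1 (FreeGroup.of (u j))) = true := hj'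
  simp [hfalse] at htrue
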